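/- Let W be a nonempty finite type, c : W → ℝ with 0 ≤ c w for all w and 0 < c w₀ for some w₀, and let f, g : W → ℝ. If ∑_{w ∈ W} Q_f w * Real.log (P_g w) ≥ ∑_{w ∈ W} Q_f w * Real.log (P_f w), then L(g) ≥ L(f). In particular, each maximization step of the expected complete log-likelihood under the posterior Q_f does not decrease the marginal likelihood L. -/

import Mathlib

/-- The softmax (Gibbs) distribution associated with logits `f`. -/
noncomputable def softmax {W : Type*} [Fintype W] (f : W → ℝ) (w : W) : ℝ :=
  Real.exp (f w) / ∑ w', Real.exp (f w')

/-- The log-partition function of the logits `f`. -/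
noncomputable def logPartition {W : Type*} [Fintype W] (f : W → ℝ) : ℝ :=
  Real.log (∑ w, Real.exp (f w))

/-- Kullback–Leibler divergence between finitely supported densities `p` and `q`
(with the convention `0 * log 0 = 0`, which holds definitionally in `ℝ`). -/
noncomputable def KLdiv {W : Type*} [Fintype W] (p q : W → ℝ) : ℝ :=
  ∑ w, p w * Real.log (p w / q w)

/-- Marginal likelihood: the `c`-weighted total mass of the softmax distribution of `f`. -/
noncomputable def margL {W : Type*} [Fintype W] (c f : W → ℝ) : ℝ :=
  ∑ w, c w * softmax f w

/-- Posterior distribution obtained by reweighting the softmax distribution of `f`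
by the evaluation weights `c` and normalizing. -/
noncomputable def post {W : Type*} [Fintype W] (c f : W → ℝ) (w : W) : ℝ :=
  c w * softmax f w / margL c f

lemma softmax_pos {W : Type*} [Fintype W] [Nonempty W] (f : W → ℝ) (w : W) :
    0 < softmax f w :=
  div_pos (Real.exp_pos _)
    (Finset.sum_pos (fun _ _ => Real.exp_pos _) Finset.univ_nonempty)

lemma margL_pos {W : Type*} [Fintype W] [Nonempty W] {c : W → ℝ} (hc : ∀ w, 0 ≤ c w)
    {w₀ : W} (hc₀ : 0 < c w₀) (f : W → ℝ) : 0 < margL c f :=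
  Finset.sum_pos' (fun w _ => mul_nonneg (hc w) (softmax_pos f w).le)
    ⟨w₀, Finset.mem_univ _, mul_pos hc₀ (softmax_pos f w₀)⟩

/-- The gain in expected complete log-likelihood is at most the relative gain in
marginal likelihood. -/
lemma sum_post_mul_log_sub_le {W : Type*} [Fintype W] [Nonempty W] {c : W → ℝ}
    (hc : ∀ w, 0 ≤ c w) {w₀ : W} (hc₀ : 0 < c w₀) (f g : W → ℝ) :
    ∑ w, post c f w * Real.log (softmax g w) - ∑ w, post c f w * Real.log (softmax f w) ≤
      (margL c g - margL c f) / margL c f := by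
  have hL := margL_pos hc hc₀ f
  have hR : (margL c g - margL c f) / margL c f =
      ∑ w, post c f w * (softmax g w / softmax f w - 1) := by
    conv_lhs => enter [1]; rw [margL, margL, ← Finset.sum_sub_distrib]
    rw [Finset.sum_div]
    refine Finset.sum_congr rfl fun w _ => ?_
    have hf := (softmax_pos f w).ne'
    rw [post]
    field_simp
  rw [hR, ← Finset.sum_sub_distrib]
  refine Finset.sum_le_sum fun w _ => ?_
  have hf := softmax_pos f w
  have hg := softmax_pos g w
  rw [← mul_sub, ← Real.log_div hg.ne' hf.ne']
  exact mul_le_mul_of_nonneg_left (Real.log_le_sub_one_of_pos (div_pos hg hf))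
    (div_nonneg (mul_nonneg (hc w) hf.le) hL.le)

/-- EM-type monotonicity: if `g` does not decrease the expected complete log-likelihood
under the posterior `Q_f`, then the marginal likelihood does not decrease. -/
theorem margL_mono_of_expected_loglik_ge {W : Type*} [Fintype W] [Nonempty W]
    (c : W → ℝ) (hc : ∀ w, 0 ≤ c w) (w₀ : W) (hc₀ : 0 < c w₀) (f g : W → ℝ)
    (h : ∑ w, post c f w * Real.log (softmax g w) ≥
        ∑ w, post c f w * Real.log (softmax f w)) :
    margL c g ≥ margL c f := by
  have hL := margL_pos hc hc₀ f
  have hgain := (sub_nonneg.2 h).trans (sum_post_mul_log_sub_le hc hc₀ f g)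
  rwa [le_div_iff₀ hL, zero_mul, sub_nonneg] at hgain
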